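/- Assume π has nilpotency 3 (π^3 = 0, π^2 ≠ 0). Let r, b_{21}… no b_{21} here: let r, b_{11}, b_{01}, b_{02} ∈ R[x] with r̄ irreducible in F[x], let e_0 ≥ e_1 ≥ e_2 ≥ 0 be integers with e_0 > 0, and let I be an ideal of R[x] with canonical sequence (f_0, f_1, f_2) where f_2 = r^{e_2}, f_1 = r^{e_1} + π b_{11}, and f_0 = r^{e_0} + π(b_{11} r^{e_0−e_1} + b_{01} r^{e_2}) + π^2 b_{02}. Then: (i) if the set {e_0, e_1, e_2, 0} has exactly 2 elements, then R[x]/I is Frobenius and local; (ii) if e_0 = e_1 > e_2 > 0, then R[x]/I is Frobenius and local if and only if r̄ ∤ b̄_{11}; (iii) if e_0 > e_1 = e_2 > 0, then R[x]/I is Frobenius and local if and only if r̄ ∤ (b̄_{02} − b̄_{01} b̄_{11}); (iv) if e_0 > e_1 > e_2 = 0, then R[x]/I is Frobenius and local if and only if r̄ ∤ b̄_{01}; (v) if e_0 > e_1 > e_2 > 0, then R[x]/I is Frobenius and local if and only if r̄ ∤ b̄_{11} and r̄ ∤ b̄_{01}. -/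

import Mathlib

open Polynomial

/-- A commutative ring `S` is *Frobenius* if it is artinian and `S/rad(S)` is isomorphic,
as an `S`-module, to the socle of `S` (the sum of all minimal ideals of `S`). -/
def IsFrobeniusRing (S : Type*) [CommRing S] : Prop :=
  IsArtinianRing S ∧
    Nonempty ((S ⧸ Ideal.jacobson (⊥ : Ideal S)) ≃ₗ[S]
      (sSup {J : Ideal S | IsAtom J} : Ideal S))

/-- The reduction map `R[x] → (R/πR)[x]`. -/
noncomputable def redMod {R : Type*} [CommRing R] (π : R) :
    R[X] →+* (R ⧸ Ideal.span {π})[X] :=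
  Polynomial.mapRingHom (Ideal.Quotient.mk (Ideal.span {π}))

/-- `(f 0, …, f (n-1))` is a canonical sequence of the ideal `I` of `R[x]`. -/
def IsCanonicalSequence {R : Type*} [CommRing R] (π : R) (n : ℕ)
    (I : Ideal R[X]) (f : ℕ → R[X]) : Prop :=
  ∀ i < n, (C π ^ i * f i ∈ I) ∧
    ∀ g : R[X], C π ^ i * g ∈ I →
      redMod π g = 0 ∨ (redMod π (f i) ≠ 0 ∧ (redMod π (f i)).degree ≤ (redMod π g).degree)

section Frobenius

variable {S : Type*} [CommRing S]

theorem isAtom_span_singleton_of_maximalIdeal_smul_eq_zero [IsLocalRing S] {s : S} (hs : s ≠ 0)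
    (hm : ∀ a ∈ IsLocalRing.maximalIdeal S, a * s = 0) : IsAtom (Ideal.span {s}) := by
  refine ⟨by simpa using hs, fun J hJ => ?_⟩
  rw [eq_bot_iff]
  intro x hx
  obtain ⟨a, rfl⟩ := Ideal.mem_span_singleton'.1 (hJ.le hx)
  by_cases ha : IsUnit a
  · refine absurd ?_ hJ.not_ge
    rw [Ideal.span_singleton_le_iff_mem]
    exact (Ideal.unit_mul_mem_iff_mem J ha).1 hx
  · exact hm a ha

theorem maximalIdeal_mul_eq_zero_of_isAtom [IsLocalRing S] [IsNoetherianRing S] {J : Ideal S}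
    (hJ : IsAtom J) {a x : S} (ha : a ∈ IsLocalRing.maximalIdeal S) (hx : x ∈ J) : a * x = 0 := by
  have hle : IsLocalRing.maximalIdeal S • J ≤ J := Submodule.smul_le_right
  rcases hJ.le_iff.1 hle with h | h
  · have : a * x ∈ IsLocalRing.maximalIdeal S • J := Submodule.smul_mem_smul ha hx
    rwa [h] at this
  · refine absurd ?_ hJ.1
    exact Submodule.eq_bot_of_le_smul_of_le_jacobson_bot _ J (IsNoetherian.noetherian J) h.ge
      (IsLocalRing.maximalIdeal_le_jacobson _)

theorem isFrobeniusRing_iff_exists_socle_generator [IsLocalRing S] [IsArtinianRing S] :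
    IsFrobeniusRing S ↔ ∃ s : S, s ≠ 0 ∧ (∀ a ∈ IsLocalRing.maximalIdeal S, a * s = 0) ∧
      ∀ g : S, (∀ a ∈ IsLocalRing.maximalIdeal S, a * g = 0) → s ∣ g := by
  have hjac : Ideal.jacobson (⊥ : Ideal S) = IsLocalRing.maximalIdeal S :=
    IsLocalRing.jacobson_eq_maximalIdeal ⊥ bot_ne_top
  constructor
  · rintro ⟨-, ⟨φ⟩⟩
    have hφ : ∀ a : S, φ (Ideal.Quotient.mk _ a) = a • φ 1 := fun a => by
      rw [← map_smul]
      congr 1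
      rw [← map_one (Ideal.Quotient.mk _), ← Ideal.Quotient.mk_eq_mk, ← Ideal.Quotient.mk_eq_mk,
        ← Submodule.Quotient.mk_smul, smul_eq_mul, mul_one]
    refine ⟨φ 1, fun h => ?_, fun a ha => ?_, fun g hg => ?_⟩
    · have h1 : φ 1 = 0 := Subtype.ext h
      rw [LinearEquiv.map_eq_zero_iff, ← map_one (Ideal.Quotient.mk _),
        Ideal.Quotient.eq_zero_iff_mem, hjac] at h1
      exact h1 isUnit_one
    · have h1 := hφ a
      rw [Ideal.Quotient.eq_zero_iff_mem.2 (hjac ▸ ha), map_zero] at h1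
      simpa using (congrArg Subtype.val h1).symm
    · by_cases hg0 : g = 0
      · simp [hg0]
      have hat := isAtom_span_singleton_of_maximalIdeal_smul_eq_zero hg0 hg
      have hmem : g ∈ (sSup {J : Ideal S | IsAtom J} : Ideal S) :=
        (le_sSup (show Ideal.span {g} ∈ {J : Ideal S | IsAtom J} from hat))
          (Ideal.mem_span_singleton_self g)
      obtain ⟨y, hy⟩ := φ.surjective ⟨g, hmem⟩
      obtain ⟨a, rfl⟩ := Ideal.Quotient.mk_surjective y
      rw [hφ] at hy
      exact ⟨a, by rw [mul_comm]; simpa using (congrArg Subtype.val hy).symm⟩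
  · rintro ⟨s, hs, hsm, hgen⟩
    refine ⟨inferInstance, ?_⟩
    have hsoc : (sSup {J : Ideal S | IsAtom J} : Ideal S) = Submodule.span S {s} := by
      refine le_antisymm (sSup_le fun J hJ x hx => ?_)
        (le_sSup (isAtom_span_singleton_of_maximalIdeal_smul_eq_zero hs hsm))
      exact Ideal.mem_span_singleton.2
        (hgen x fun a ha => maximalIdeal_mul_eq_zero_of_isAtom hJ ha hx)
    have htors : Ideal.jacobson (⊥ : Ideal S) = Ideal.torsionOf S S s := by
      rw [hjac]
      ext a
      rw [Ideal.mem_torsionOf_iff, smul_eq_mul]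
      refine ⟨hsm a, fun h => ?_⟩
      by_contra hu
      rw [IsLocalRing.mem_maximalIdeal, mem_nonunits_iff, not_not] at hu
      exact hs ((hu.mul_right_eq_zero).1 h)
    rw [hsoc, htors]
    exact ⟨Ideal.quotTorsionOfEquivSpanSingleton S S s⟩

/-- Any nonzero socle element tests whether an artinian local ring is Frobenius. -/
theorem isFrobeniusRing_iff_dvd_of_socle [IsLocalRing S] [IsArtinianRing S] {s : S} (hs : s ≠ 0)
    (hsm : ∀ a ∈ IsLocalRing.maximalIdeal S, a * s = 0) :
    IsFrobeniusRing S ↔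
      ∀ g : S, (∀ a ∈ IsLocalRing.maximalIdeal S, a * g = 0) → s ∣ g := by
  rw [isFrobeniusRing_iff_exists_socle_generator]
  refine ⟨?_, fun h => ⟨s, hs, hsm, h⟩⟩
  rintro ⟨t, -, htm, hgen⟩ g hg
  obtain ⟨q, hq⟩ := hgen s hsm
  have hu : IsUnit q := by
    by_contra hu
    exact hs (by rw [hq, mul_comm]; exact htm q hu)
  obtain ⟨v, rfl⟩ := hu
  exact (Dvd.intro (↑v⁻¹) (by rw [hq, mul_assoc, Units.mul_inv, mul_one])).trans (hgen g hg)

theorem isLocalRing_and_maximalIdeal_eq_of_isNilpotent {p r : S}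
    (hmax : (Ideal.span {p, r}).IsMaximal) (hp : IsNilpotent p) (hr : IsNilpotent r) :
    Ring.KrullDimLE 0 S ∧ ∃ _ : IsLocalRing S,
      IsLocalRing.maximalIdeal S = Ideal.span {p, r} := by
  have huniq : ∃! P : Ideal S, P.IsPrime := by
    refine ⟨_, hmax.isPrime, fun P hP => (hmax.eq_of_le hP.ne_top ?_).symm⟩
    rw [Ideal.span_le]
    rintro x (rfl | rfl)
    · exact (nilpotent_iff_mem_prime.1 hp) P hP
    · exact (nilpotent_iff_mem_prime.1 hr) P hP
  obtain ⟨hdim, hloc⟩ := ((Ring.krullDimLE_zero_and_isLocalRing_tfae S).out 0 1 rfl rfl).mpr huniq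
  exact ⟨hdim, hloc, (IsLocalRing.eq_maximalIdeal hmax).symm⟩

/-- Frobenius criterion for a quotient whose maximal ideal is spanned by two nilpotents, tested
on a socle element `s`. -/
theorem isFrobeniusRing_and_isLocalRing_quotient_iff {A : Type*} [CommRing A] [IsNoetherianRing A]
    {p r : A} {I : Ideal A} (hmax : (Ideal.span {p, r}).IsMaximal) (hI : I ≤ Ideal.span {p, r})
    {k l : ℕ} (hp : p ^ k ∈ I) (hr : r ^ l ∈ I) {s : A} (hs : s ∉ I) (hps : p * s ∈ I)
    (hrs : r * s ∈ I) :
    (IsFrobeniusRing (A ⧸ I) ∧ IsLocalRing (A ⧸ I)) ↔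
      ∀ g, p * g ∈ I → r * g ∈ I → ∃ q, g - q * s ∈ I := by
  have hspan : (Ideal.span {p, r}).map (Ideal.Quotient.mk I) =
      Ideal.span {Ideal.Quotient.mk I p, Ideal.Quotient.mk I r} := by
    rw [Ideal.map_span, Set.image_pair]
  have hmax' : (Ideal.span {Ideal.Quotient.mk I p, Ideal.Quotient.mk I r}).IsMaximal := by
    rw [← hspan]
    refine (Ideal.map_eq_top_or_isMaximal_of_surjective _ Ideal.Quotient.mk_surjective
      hmax).resolve_left fun h => hmax.ne_top ?_
    have h2 := congrArg (Ideal.comap (Ideal.Quotient.mk I)) h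
    rwa [Ideal.comap_map_of_surjective _ Ideal.Quotient.mk_surjective, Ideal.comap_top,
      ← RingHom.ker_eq_comap_bot, Ideal.mk_ker, sup_eq_left.2 hI] at h2
  obtain ⟨hdim, hloc, hm⟩ := isLocalRing_and_maximalIdeal_eq_of_isNilpotent hmax'
    ⟨k, by rw [← map_pow]; exact Ideal.Quotient.eq_zero_iff_mem.2 hp⟩
    ⟨l, by rw [← map_pow]; exact Ideal.Quotient.eq_zero_iff_mem.2 hr⟩
  have : IsArtinianRing (A ⧸ I) := IsNoetherianRing.isArtinianRing_of_krullDimLE_zero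
  have hsocle : ∀ g : A, (∀ a ∈ IsLocalRing.maximalIdeal (A ⧸ I), a * Ideal.Quotient.mk I g = 0) ↔
      p * g ∈ I ∧ r * g ∈ I := by
    intro g
    rw [hm, ← Ideal.Quotient.eq_zero_iff_mem, ← Ideal.Quotient.eq_zero_iff_mem, map_mul, map_mul]
    refine ⟨fun h => ⟨h _ (Ideal.subset_span (by simp)), h _ (Ideal.subset_span (by simp))⟩, ?_⟩
    rintro ⟨h1, h2⟩ a ha
    obtain ⟨u, v, rfl⟩ := Ideal.mem_span_pair.1 ha
    rw [add_mul, mul_assoc, mul_assoc, h1, h2, mul_zero, mul_zero, add_zero]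
  rw [and_iff_left hloc, isFrobeniusRing_iff_dvd_of_socle
    (s := Ideal.Quotient.mk I s) (by rwa [Ne, Ideal.Quotient.eq_zero_iff_mem])
    ((hsocle s).2 ⟨hps, hrs⟩), Ideal.Quotient.mk_surjective.forall]
  refine forall_congr' fun g => ?_
  rw [hsocle, and_imp]
  refine forall₂_congr fun _ _ => ?_
  rw [dvd_iff_exists_eq_mul_left, Ideal.Quotient.mk_surjective.exists]
  exact exists_congr fun q => by rw [← map_mul, Ideal.Quotient.eq]

end Frobenius

/-- Data of an ideal `I` with a canonical sequence of length three and exponents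
`e + c + d`, `e + c`, `e`, where `φ` plays the role of reduction modulo `p`. -/
structure IsThreeStepIdeal {A B : Type*} [CommRing A] [CommRing B] (φ : A →+* B)
    (p r b11 b01 b02 : A) (e c d : ℕ) (I : Ideal A) : Prop where
  surjective : Function.Surjective φ
  map_eq_zero_iff : ∀ x, φ x = 0 ↔ p ∣ x
  irreducible : Irreducible (φ r)
  pow_three_eq_zero : p ^ 3 = 0
  mem_zero : r ^ (e + c + d) + p * (b11 * r ^ d + b01 * r ^ e) + p ^ 2 * b02 ∈ I
  mem_one : p * (r ^ (e + c) + p * b11) ∈ I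
  mem_two : p ^ 2 * r ^ e ∈ I
  dvd_zero : ∀ g, g ∈ I → φ r ^ (e + c + d) ∣ φ g
  dvd_one : ∀ g, p * g ∈ I → φ r ^ (e + c) ∣ φ g
  dvd_two : ∀ g, p ^ 2 * g ∈ I → φ r ^ e ∣ φ g

namespace IsThreeStepIdeal

variable {A B : Type*} [CommRing A] [CommRing B] {φ : A →+* B} {p r b11 b01 b02 : A}
  {e c d : ℕ} {I : Ideal A}

theorem map_self (h : IsThreeStepIdeal φ p r b11 b01 b02 e c d I) : φ p = 0 :=
  (h.map_eq_zero_iff p).2 dvd_rfl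

theorem pow_three_mem (h : IsThreeStepIdeal φ p r b11 b01 b02 e c d I) : p ^ 3 ∈ I := by
  rw [h.pow_three_eq_zero]
  exact I.zero_mem

theorem exists_of_map_dvd (h : IsThreeStepIdeal φ p r b11 b01 b02 e c d I) {x y : A}
    (hxy : φ x ∣ φ y) : ∃ t u, y = x * t + p * u := by
  obtain ⟨z, hz⟩ := hxy
  obtain ⟨t, rfl⟩ := h.surjective z
  obtain ⟨u, hu⟩ := (h.map_eq_zero_iff (y - x * t)).1 (by rw [map_sub, map_mul, hz, sub_self])
  exact ⟨t, u, by linear_combination hu⟩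

theorem span_eq_comap (h : IsThreeStepIdeal φ p r b11 b01 b02 e c d I) :
    Ideal.span {p, r} = (Ideal.span {φ r}).comap φ := by
  ext x
  rw [Ideal.mem_span_pair, Ideal.mem_comap, Ideal.mem_span_singleton]
  constructor
  · rintro ⟨u, v, rfl⟩
    simp [h.map_self]
  · intro hx
    obtain ⟨t, u, rfl⟩ := h.exists_of_map_dvd hx
    exact ⟨u, t, by ring⟩

theorem exists_decomposition (h : IsThreeStepIdeal φ p r b11 b01 b02 e c d I) {g : A}
    (hpg : p * g ∈ I) :
    ∃ a b y, g = a * (r ^ (e + c) + p * b11) + b * p * r ^ e + y * p ^ 2 := by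
  obtain ⟨a, u, hu⟩ := h.exists_of_map_dvd (x := r ^ (e + c)) (by simpa using h.dvd_one g hpg)
  have h1 : p ^ 2 * (u - a * b11) ∈ I := by
    convert I.sub_mem hpg (I.mul_mem_left a h.mem_one) using 1
    rw [hu]; ring
  obtain ⟨b, y, hy⟩ := h.exists_of_map_dvd (x := r ^ e) (y := u - a * b11)
    (by rw [map_pow]; exact h.dvd_two _ h1)
  exact ⟨a, b, y, by linear_combination hu + p * hy⟩

theorem exists_sub_mem_of_eq (h : IsThreeStepIdeal φ p r b11 b01 b02 e c 0 I) {g : A}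
    (hpg : p * g ∈ I) : ∃ b y, g - (b * p * r ^ e + y * p ^ 2) ∈ I := by
  obtain ⟨a, b, y, rfl⟩ := h.exists_decomposition hpg
  refine ⟨b - a * b01, y - a * b02, ?_⟩
  convert I.mul_mem_left a h.mem_zero using 1
  ring

theorem isMaximal_span [IsPrincipalIdealRing B]
    (h : IsThreeStepIdeal φ p r b11 b01 b02 e c d I) :
    (Ideal.span {p, r}).IsMaximal := by
  rw [h.span_eq_comap]
  have := PrincipalIdealRing.isMaximal_of_irreducible h.irreducible
  exact Ideal.comap_isMaximal_of_surjective φ h.surjective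

theorem frobenius_iff [IsPrincipalIdealRing B] [IsNoetherianRing A]
    (h : IsThreeStepIdeal φ p r b11 b01 b02 e c d I) (hpos : e + c + d ≠ 0)
    {s : A} (hs : s ∉ I) (hps : p * s ∈ I) (hrs : r * s ∈ I) :
    (IsFrobeniusRing (A ⧸ I) ∧ IsLocalRing (A ⧸ I)) ↔
      ∀ g, p * g ∈ I → r * g ∈ I → ∃ q, g - q * s ∈ I := by
  have hI : I ≤ Ideal.span {p, r} := fun g hg => by
    rw [h.span_eq_comap, Ideal.mem_comap, Ideal.mem_span_singleton]
    exact (dvd_pow_self _ hpos).trans (h.dvd_zero g hg)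
  refine isFrobeniusRing_and_isLocalRing_quotient_iff h.isMaximal_span hI h.pow_three_mem
    (l := (e + c + d) * 3) ?_ hs hps hrs
  set z := b11 * r ^ d + b01 * r ^ e + p * b02
  have hz : r ^ (e + c + d) + p * z ∈ I := by
    convert h.mem_zero using 1
    ring
  set x := r ^ (e + c + d)
  rw [pow_mul]
  convert I.sub_mem (I.mul_mem_left (x ^ 2 - x * (p * z) + (p * z) ^ 2) hz)
    (I.mul_mem_left (z ^ 3) h.pow_three_mem) using 1
  ring

theorem exists_sub_mem_of_dvd (h : IsThreeStepIdeal φ p r b11 b01 b02 e c (d + 1) I) {q : A}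
    (hq : φ r ∣ φ q) (g b y : A)
    (hg : g - (q * r ^ d * (r ^ (e + c) + p * b11) + b * p * r ^ e + y * p ^ 2) ∈ I) :
    ∃ b y, g - (b * p * r ^ e + y * p ^ 2) ∈ I := by
  obtain ⟨t, u, rfl⟩ := h.exists_of_map_dvd hq
  refine ⟨b - t * b01, y - t * b02, ?_⟩
  convert I.add_mem hg (I.add_mem (I.mul_mem_left t h.mem_zero)
    (I.mul_mem_left (u * r ^ d) h.mem_one)) using 1
  ring

theorem exists_sub_mul_sq_mem_of_eq (h : IsThreeStepIdeal φ p r b11 b01 b02 e 0 d I) {g b y : A}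
    (hg : g - (b * p * r ^ e + y * p ^ 2) ∈ I) : ∃ y, g - y * p ^ 2 ∈ I := by
  refine ⟨y - b11 * b, ?_⟩
  convert I.add_mem hg (I.mul_mem_left b h.mem_one) using 1
  ring

section Domain

variable [IsDomain B]

theorem exists_pow_decomposition (h : IsThreeStepIdeal φ p r b11 b01 b02 e c (d + 1) I) {g : A}
    (hpg : p * g ∈ I) (hrg : r * g ∈ I) :
    ∃ q b y, g - (q * r ^ d * (r ^ (e + c) + p * b11) + b * p * r ^ e + y * p ^ 2) ∈ I := by
  obtain ⟨a, b, y, rfl⟩ := h.exists_decomposition hpg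
  have h1 := h.dvd_zero _ hrg
  have h2 : φ r ^ (e + c + 1) * φ r ^ d ∣ φ r ^ (e + c + 1) * φ a := by
    convert h1 using 1
    · ring
    · simp only [map_mul, map_add, map_pow, h.map_self]; ring
  rw [mul_dvd_mul_iff_left (pow_ne_zero _ h.irreducible.ne_zero), ← map_pow] at h2
  obtain ⟨q, u, rfl⟩ := h.exists_of_map_dvd h2
  refine ⟨q, b, y, ?_⟩
  convert I.mul_mem_left u h.mem_one using 1
  ring

theorem exists_sub_mul_socle_mem (h : IsThreeStepIdeal φ p r b11 b01 b02 (e + 1) c d I) {g y : A}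
    (hrg : r * g ∈ I) (hg : g - y * p ^ 2 ∈ I) : ∃ q, g - q * (p ^ 2 * r ^ e) ∈ I := by
  have h1 : p ^ 2 * (r * y) ∈ I := by
    convert I.sub_mem hrg (I.mul_mem_left r hg) using 1
    ring
  have h2 := h.dvd_two _ h1
  rw [map_mul, pow_succ', mul_dvd_mul_iff_left h.irreducible.ne_zero, ← map_pow] at h2
  obtain ⟨q, u, rfl⟩ := h.exists_of_map_dvd h2
  refine ⟨q, ?_⟩
  convert I.add_mem hg (I.mul_mem_left u h.pow_three_mem) using 1
  ring

theorem exists_sub_mul_linear_socle_mem (h : IsThreeStepIdeal φ p r b11 b01 b02 0 (c + 1) d I)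
    {g b y : A} (hrg : r * g ∈ I) (hg : g - (b * p * r ^ 0 + y * p ^ 2) ∈ I) :
    ∃ q, g - q * (p * r ^ c) ∈ I := by
  have hp2 : p ^ 2 ∈ I := by simpa using h.mem_two
  have h1 : p * (r * b) ∈ I := by
    convert I.sub_mem hrg (I.add_mem (I.mul_mem_left r hg) (I.mul_mem_left (r * y) hp2)) using 1
    ring
  have h2 := h.dvd_one _ h1
  rw [zero_add, map_mul, pow_succ', mul_dvd_mul_iff_left h.irreducible.ne_zero, ← map_pow] at h2
  obtain ⟨q, u, rfl⟩ := h.exists_of_map_dvd h2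
  refine ⟨q, ?_⟩
  convert I.add_mem hg (I.mul_mem_left (u + y) hp2) using 1
  ring

theorem not_pow_succ_dvd (h : IsThreeStepIdeal φ p r b11 b01 b02 e c d I) (n : ℕ) :
    ¬ φ r ^ (n + 1) ∣ φ r ^ n := fun hd =>
  absurd ((pow_dvd_pow_iff h.irreducible.ne_zero h.irreducible.not_isUnit).1 hd) (by simp)

/-- Socle elements of this shape are not multiples modulo `I` of elements of `(p)`. -/
theorem not_exists_sub_mul_mem (h : IsThreeStepIdeal φ p r b11 b01 b02 e c (d + 1) I)
    (x s : A) : ¬ ∃ q, r ^ d * (r ^ (e + c) + p * b11) + p * x - q * (p * s) ∈ I := by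
  rintro ⟨q, hq⟩
  refine h.not_pow_succ_dvd (e + c + d) ?_
  convert h.dvd_zero _ hq using 1
  · ring
  · simp only [map_sub, map_add, map_mul, map_pow, h.map_self]; ring

variable [IsPrincipalIdealRing B]

theorem exists_sub_mem_of_lt (h : IsThreeStepIdeal φ p r b11 b01 b02 e (c + 1) (d + 1) I)
    (hb : ¬ φ r ∣ φ b01) {g : A} (hpg : p * g ∈ I) (hrg : r * g ∈ I) :
    ∃ b y, g - (b * p * r ^ e + y * p ^ 2) ∈ I := by
  obtain ⟨q, b, y, hg⟩ := h.exists_pow_decomposition hpg hrg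
  refine h.exists_sub_mem_of_dvd (q := q) ?_ g b y hg
  have h1 : p * (b * r ^ (e + 1) - q * b01 * r ^ e + p * (y * r - q * b02)) ∈ I := by
    convert I.sub_mem hrg (I.add_mem (I.mul_mem_left r hg) (I.mul_mem_left q h.mem_zero)) using 1
    ring
  have h2 : φ r ^ e * φ r ^ (c + 1) ∣ φ r ^ e * (φ b * φ r - φ q * φ b01) := by
    convert h.dvd_one _ h1 using 1
    · ring
    · simp only [map_mul, map_add, map_sub, map_pow, h.map_self]; ring
  rw [mul_dvd_mul_iff_left (pow_ne_zero _ h.irreducible.ne_zero)] at h2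
  have h3 : φ r ∣ φ q * φ b01 :=
    (dvd_sub_right (Dvd.intro_left _ rfl)).1 ((dvd_pow_self _ c.succ_ne_zero).trans h2)
  exact (h.irreducible.prime.dvd_or_dvd h3).resolve_right hb

theorem exists_sub_mem_of_middle_eq (h : IsThreeStepIdeal φ p r b11 b01 b02 (e + 1) 0 (d + 1) I)
    (hb : ¬ φ r ∣ φ b02 - φ b01 * φ b11) {g : A} (hpg : p * g ∈ I) (hrg : r * g ∈ I) :
    ∃ b y, g - (b * p * r ^ (e + 1) + y * p ^ 2) ∈ I := by
  obtain ⟨q, b, y, hg⟩ := h.exists_pow_decomposition hpg hrg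
  refine h.exists_sub_mem_of_dvd (q := q) ?_ g b y hg
  have h1 : p ^ 2 * (r * (y - b11 * b) - q * (b02 - b01 * b11)) ∈ I := by
    convert I.sub_mem hrg (I.add_mem (I.mul_mem_left r hg) (I.add_mem (I.mul_mem_left q h.mem_zero)
      (I.mul_mem_left (b * r - q * b01) h.mem_one))) using 1
    ring
  have h2 := (dvd_pow_self _ e.succ_ne_zero).trans (h.dvd_two _ h1)
  rw [map_sub, map_mul, dvd_sub_right (Dvd.intro _ rfl), map_mul, map_sub φ b02, map_mul] at h2
  exact (h.irreducible.prime.dvd_or_dvd h2).resolve_right hb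

theorem exists_sub_mul_sq_mem (h : IsThreeStepIdeal φ p r b11 b01 b02 (e + 1) (c + 1) d I)
    (hb : ¬ φ r ∣ φ b11) {g b y : A} (hrg : r * g ∈ I)
    (hg : g - (b * p * r ^ (e + 1) + y * p ^ 2) ∈ I) : ∃ y, g - y * p ^ 2 ∈ I := by
  have h1 : p * (b * r ^ (e + 2) + p * (y * r)) ∈ I := by
    convert I.sub_mem hrg (I.mul_mem_left r hg) using 1
    ring
  have h2 : φ r ^ (e + 2) * φ r ^ c ∣ φ r ^ (e + 2) * φ b := by
    convert h.dvd_one _ h1 using 1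
    · ring
    · simp only [map_mul, map_add, map_pow, h.map_self]; ring
  rw [mul_dvd_mul_iff_left (pow_ne_zero _ h.irreducible.ne_zero), ← map_pow] at h2
  obtain ⟨t, u, rfl⟩ := h.exists_of_map_dvd h2
  have h3 : p ^ 2 * (r * y - t * b11) ∈ I := by
    convert I.sub_mem h1 (I.add_mem (I.mul_mem_left t h.mem_one)
      (I.mul_mem_left (u * r) h.mem_two)) using 1
    ring
  have h4 := (dvd_pow_self _ e.succ_ne_zero).trans (h.dvd_two _ h3)
  rw [map_sub, map_mul, dvd_sub_right (Dvd.intro _ rfl), map_mul] at h4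
  obtain ⟨v, w, rfl⟩ := h.exists_of_map_dvd ((h.irreducible.prime.dvd_or_dvd h4).resolve_right hb)
  refine ⟨y - b11 * v, ?_⟩
  convert I.add_mem hg (I.add_mem (I.mul_mem_left v h.mem_one)
    (I.mul_mem_left (w * r ^ c + u) h.mem_two)) using 1
  ring

variable [IsNoetherianRing A]

theorem frobenius_iff_of_pos (h : IsThreeStepIdeal φ p r b11 b01 b02 (e + 1) c d I) :
    (IsFrobeniusRing (A ⧸ I) ∧ IsLocalRing (A ⧸ I)) ↔
      ∀ g, p * g ∈ I → r * g ∈ I → ∃ q, g - q * (p ^ 2 * r ^ e) ∈ I := by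
  refine h.frobenius_iff (by omega) (fun hs => ?_) ?_ ?_
  · exact h.not_pow_succ_dvd e (by simpa using h.dvd_two _ hs)
  · convert I.mul_mem_left (r ^ e) h.pow_three_mem using 1
    ring
  · convert h.mem_two using 1
    ring

theorem frobenius_iff_of_zero_of_pos (h : IsThreeStepIdeal φ p r b11 b01 b02 0 (c + 1) d I) :
    (IsFrobeniusRing (A ⧸ I) ∧ IsLocalRing (A ⧸ I)) ↔
      ∀ g, p * g ∈ I → r * g ∈ I → ∃ q, g - q * (p * r ^ c) ∈ I := by
  refine h.frobenius_iff (by omega) (fun hs => ?_) ?_ ?_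
  · exact h.not_pow_succ_dvd c (by simpa using h.dvd_one _ hs)
  · convert I.mul_mem_left (r ^ c) h.mem_two using 1
    ring
  · convert I.sub_mem h.mem_one (I.mul_mem_left b11 h.mem_two) using 1
    ring

theorem frobenius_of_all_eq (h : IsThreeStepIdeal φ p r b11 b01 b02 (e + 1) 0 0 I) :
    IsFrobeniusRing (A ⧸ I) ∧ IsLocalRing (A ⧸ I) := by
  refine h.frobenius_iff_of_pos.2 fun g hpg hrg => ?_
  obtain ⟨b, y, hg⟩ := h.exists_sub_mem_of_eq hpg
  obtain ⟨y, hy⟩ := h.exists_sub_mul_sq_mem_of_eq hg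
  exact h.exists_sub_mul_socle_mem hrg hy

theorem frobenius_of_last_zero (h : IsThreeStepIdeal φ p r b11 b01 b02 0 (c + 1) 0 I) :
    IsFrobeniusRing (A ⧸ I) ∧ IsLocalRing (A ⧸ I) := by
  refine h.frobenius_iff_of_zero_of_pos.2 fun g hpg hrg => ?_
  obtain ⟨b, y, hg⟩ := h.exists_sub_mem_of_eq hpg
  exact h.exists_sub_mul_linear_socle_mem hrg hg

theorem frobenius_of_last_two_zero (h : IsThreeStepIdeal φ p r b11 b01 b02 0 0 (d + 1) I) :
    IsFrobeniusRing (A ⧸ I) ∧ IsLocalRing (A ⧸ I) := by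
  have hp2 : p ^ 2 ∈ I := by simpa using h.mem_two
  have hp : p ∈ I := by
    convert I.sub_mem h.mem_one (I.mul_mem_left b11 hp2) using 1
    ring
  refine (h.frobenius_iff (by omega) (s := r ^ d) (fun hs => ?_) (I.mul_mem_right _ hp) ?_).2
    fun g _ hrg => ?_
  · exact h.not_pow_succ_dvd d (by simpa using h.dvd_zero _ hs)
  · convert I.sub_mem h.mem_zero
      (I.mul_mem_left (b11 * r ^ (d + 1) + b01 + p * b02) hp) using 1
    ring
  · have h2 := h.dvd_zero _ hrg
    rw [zero_add, zero_add, map_mul, pow_succ', mul_dvd_mul_iff_left h.irreducible.ne_zero,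
      ← map_pow] at h2
    obtain ⟨q, u, rfl⟩ := h.exists_of_map_dvd h2
    refine ⟨q, ?_⟩
    convert I.mul_mem_left u hp using 1
    ring

theorem not_dvd_b11_of_frobenius (h : IsThreeStepIdeal φ p r b11 b01 b02 (e + 1) (c + 1) d I)
    (hF : IsFrobeniusRing (A ⧸ I) ∧ IsLocalRing (A ⧸ I)) : ¬ φ r ∣ φ b11 := by
  intro hb
  obtain ⟨t, u, hu⟩ := h.exists_of_map_dvd hb
  obtain ⟨q, hq⟩ := h.frobenius_iff_of_pos.1 hF (p * r ^ (e + 1 + c) + p ^ 2 * t) (by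
    convert I.add_mem (I.mul_mem_left (r ^ c) h.mem_two) (I.mul_mem_left t h.pow_three_mem) using 1
    ring) (by
    convert I.sub_mem h.mem_one (I.mul_mem_left u h.pow_three_mem) using 1
    rw [hu]; ring)
  refine h.not_pow_succ_dvd (e + 1 + c) ?_
  have h1 := h.dvd_one (r ^ (e + 1 + c) + p * (t - q * r ^ e)) (by
    convert hq using 1
    ring)
  simpa [h.map_self, add_assoc] using h1

theorem frobenius_iff_of_first_eq (h : IsThreeStepIdeal φ p r b11 b01 b02 (e + 1) (c + 1) 0 I) :
    (IsFrobeniusRing (A ⧸ I) ∧ IsLocalRing (A ⧸ I)) ↔ ¬ φ r ∣ φ b11 := by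
  refine ⟨h.not_dvd_b11_of_frobenius, fun hb => h.frobenius_iff_of_pos.2 fun g hpg hrg => ?_⟩
  obtain ⟨b, y, hg⟩ := h.exists_sub_mem_of_eq hpg
  obtain ⟨y, hy⟩ := h.exists_sub_mul_sq_mem hb hrg hg
  exact h.exists_sub_mul_socle_mem hrg hy

theorem frobenius_iff_of_middle_eq (h : IsThreeStepIdeal φ p r b11 b01 b02 (e + 1) 0 (d + 1) I) :
    (IsFrobeniusRing (A ⧸ I) ∧ IsLocalRing (A ⧸ I)) ↔ ¬ φ r ∣ φ b02 - φ b01 * φ b11 := by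
  refine ⟨fun hF hb => ?_, fun hb => h.frobenius_iff_of_pos.2 fun g hpg hrg => ?_⟩
  · rw [← map_mul, ← map_sub] at hb
    obtain ⟨t, u, hu⟩ := h.exists_of_map_dvd hb
    refine h.not_exists_sub_mul_mem (p * t) (p * r ^ e) ?_
    simp only [← mul_assoc p p, ← pow_two]
    refine h.frobenius_iff_of_pos.1 hF _ ?_ ?_
    · convert I.add_mem (I.mul_mem_left (r ^ d) h.mem_one)
        (I.mul_mem_left t h.pow_three_mem) using 1
      ring
    · convert I.sub_mem h.mem_zero (I.add_mem (I.mul_mem_left b01 h.mem_one)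
        (I.mul_mem_left u h.pow_three_mem)) using 1
      linear_combination (-p ^ 2) * hu
  · obtain ⟨b, y, hg⟩ := h.exists_sub_mem_of_middle_eq hb hpg hrg
    obtain ⟨y, hy⟩ := h.exists_sub_mul_sq_mem_of_eq hg
    exact h.exists_sub_mul_socle_mem hrg hy

theorem frobenius_iff_of_last_zero (h : IsThreeStepIdeal φ p r b11 b01 b02 0 (c + 1) (d + 1) I) :
    (IsFrobeniusRing (A ⧸ I) ∧ IsLocalRing (A ⧸ I)) ↔ ¬ φ r ∣ φ b01 := by
  refine ⟨fun hF hb => ?_, fun hb => h.frobenius_iff_of_zero_of_pos.2 fun g hpg hrg => ?_⟩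
  · obtain ⟨t, u, hu⟩ := h.exists_of_map_dvd hb
    refine h.not_exists_sub_mul_mem t (r ^ c) ?_
    refine h.frobenius_iff_of_zero_of_pos.1 hF _ ?_ ?_
    · convert I.add_mem (I.mul_mem_left (r ^ d) h.mem_one) (I.mul_mem_left t h.mem_two) using 1
      ring
    · convert I.sub_mem h.mem_zero (I.mul_mem_left (b02 + u) h.mem_two) using 1
      rw [hu]; ring
  · obtain ⟨b, y, hg⟩ := h.exists_sub_mem_of_lt hb hpg hrg
    exact h.exists_sub_mul_linear_socle_mem hrg hg

theorem frobenius_iff_of_strict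
    (h : IsThreeStepIdeal φ p r b11 b01 b02 (e + 1) (c + 1) (d + 1) I) :
    (IsFrobeniusRing (A ⧸ I) ∧ IsLocalRing (A ⧸ I)) ↔ (¬ φ r ∣ φ b11 ∧ ¬ φ r ∣ φ b01) := by
  refine ⟨fun hF => ⟨h.not_dvd_b11_of_frobenius hF, fun hb => ?_⟩,
    fun ⟨hb, hb'⟩ => h.frobenius_iff_of_pos.2 fun g hpg hrg => ?_⟩
  · obtain ⟨t, u, hu⟩ := h.exists_of_map_dvd hb
    obtain ⟨v, w, hvw⟩ := (h.irreducible.coprime_iff_not_dvd).2 (h.not_dvd_b11_of_frobenius hF)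
    obtain ⟨v, rfl⟩ := h.surjective v
    obtain ⟨w, rfl⟩ := h.surjective w
    obtain ⟨k, hk⟩ := (h.map_eq_zero_iff (v * r + w * b11 - 1)).1 (by simp [hvw])
    refine h.not_exists_sub_mul_mem
      ((t - w * b02 * r ^ c) * r ^ (e + 1) + p * (b02 * v)) (p * r ^ e) ?_
    simp only [← mul_assoc p p, ← pow_two]
    refine h.frobenius_iff_of_pos.1 hF _ ?_ ?_
    · convert I.add_mem (I.mul_mem_left (r ^ d) h.mem_one)
        (I.add_mem (I.mul_mem_left (t - w * b02 * r ^ c) h.mem_two)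
          (I.mul_mem_left (b02 * v) h.pow_three_mem)) using 1
      ring
    · convert I.add_mem h.mem_zero (I.sub_mem (I.mul_mem_left (k * b02) h.pow_three_mem)
        (I.add_mem (I.mul_mem_left (w * b02) h.mem_one) (I.mul_mem_left u h.mem_two))) using 1
      linear_combination (p ^ 2 * b02) * hk - p * r ^ (e + 1) * hu
  · obtain ⟨b, y, hg⟩ := h.exists_sub_mem_of_lt hb' hpg hrg
    obtain ⟨y, hy⟩ := h.exists_sub_mul_sq_mem hb hrg hg
    exact h.exists_sub_mul_socle_mem hrg hy

end Domain

end IsThreeStepIdeal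

theorem isNoetherianRing_of_maximalIdeal_eq_span_singleton {R : Type*} [CommRing R]
    [IsLocalRing R] {π : R} (hmax : IsLocalRing.maximalIdeal R = Ideal.span {π})
    (hπ : IsNilpotent π) : IsNoetherianRing R := by
  refine IsNoetherianRing.of_prime fun P hP => ?_
  have hle : IsLocalRing.maximalIdeal R ≤ P := by
    rw [hmax, Ideal.span_singleton_le_iff_mem]
    exact (nilpotent_iff_mem_prime.1 hπ) P hP
  rw [← (IsLocalRing.maximalIdeal.isMaximal R).eq_of_le hP.ne_top hle, hmax]
  exact ⟨{π}, by simp⟩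

theorem redMod_surjective {R : Type*} [CommRing R] (π : R) : Function.Surjective (redMod π) :=
  Polynomial.map_surjective _ Ideal.Quotient.mk_surjective

theorem redMod_eq_zero_iff {R : Type*} [CommRing R] (π : R) (g : R[X]) :
    redMod π g = 0 ↔ C π ∣ g := by
  rw [C_dvd_iff_dvd_coeff, Polynomial.ext_iff]
  refine forall_congr' fun i => ?_
  rw [redMod, coe_mapRingHom, coeff_map, coeff_zero, Ideal.Quotient.eq_zero_iff_mem,
    Ideal.mem_span_singleton]

/-- An element of minimal degree generates the image of a colon ideal. -/
theorem map_dvd_of_degree_minimal {A K : Type*} [CommRing A] [Field K] {φ : A →+* K[X]}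
    (hφ : Function.Surjective φ) {I : Ideal A} {x f : A} (hf : x * f ∈ I)
    (hmin : ∀ g, x * g ∈ I → φ g = 0 ∨ (φ f ≠ 0 ∧ (φ f).degree ≤ (φ g).degree)) {g : A}
    (hg : x * g ∈ I) : φ f ∣ φ g := by
  by_cases hf0 : φ f = 0
  · exact (hmin g hg).elim (fun h => h ▸ dvd_zero _) fun h => absurd hf0 h.1
  obtain ⟨q, hq⟩ := hφ (φ g / φ f)
  have hmod : φ (g - q * f) = φ g % φ f := by
    rw [EuclideanDomain.mod_eq_sub_mul_div, map_sub, map_mul, hq, mul_comm]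
  have hmem : x * (g - q * f) ∈ I := by
    convert I.sub_mem hg (I.mul_mem_left q hf) using 1
    ring
  have hlt : (φ g % φ f).degree < (φ f).degree := EuclideanDomain.mod_lt _ hf0
  rcases hmin _ hmem with h | h
  · exact EuclideanDomain.mod_eq_zero.1 (hmod ▸ h)
  · rw [hmod] at h
    exact absurd h.2 hlt.not_ge

theorem IsCanonicalSequence.redMod_dvd {R : Type*} [CommRing R] {π : R}
    (hmax : (Ideal.span {π}).IsMaximal) {n : ℕ} {I : Ideal R[X]} {f : ℕ → R[X]}
    (h : IsCanonicalSequence π n I f) {i : ℕ} (hi : i < n) {g : R[X]} (hg : C π ^ i * g ∈ I) :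
    redMod π (f i) ∣ redMod π g := by
  let := Ideal.Quotient.field (Ideal.span {π})
  exact map_dvd_of_degree_minimal (K := R ⧸ Ideal.span {π}) (redMod_surjective π) (h i hi).1
    (h i hi).2 hg

theorem IsCanonicalSequence.isThreeStepIdeal {R : Type*} [CommRing R] {π : R}
    (hmax : (Ideal.span {π}).IsMaximal) (hnil : π ^ 3 = 0) {r b11 b01 b02 : R[X]}
    (hr : Irreducible (redMod π r)) {e c d : ℕ} {I : Ideal R[X]}
    (hcan : IsCanonicalSequence π 3 I (fun j =>
      if j = 0 then
        r ^ (e + c + d) + C π * (b11 * r ^ (e + c + d - (e + c)) + b01 * r ^ e) + C π ^ 2 * b02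
      else if j = 1 then r ^ (e + c) + C π * b11
      else r ^ e)) :
    IsThreeStepIdeal (redMod π) (C π) r b11 b01 b02 e c d I := by
  have hC : redMod π (C π) = 0 := (redMod_eq_zero_iff π _).2 dvd_rfl
  refine ⟨redMod_surjective π, redMod_eq_zero_iff π, hr, by rw [← C_pow, hnil, C_0],
    ?_, ?_, ?_, fun g hg => ?_, fun g hg => ?_, fun g hg => ?_⟩
  · simpa using (hcan 0 (by norm_num)).1
  · simpa using (hcan 1 (by norm_num)).1
  · simpa using (hcan 2 (by norm_num)).1
  · simpa [hC] using hcan.redMod_dvd hmax (i := 0) (by norm_num) (g := g) (by simpa using hg)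
  · simpa [hC] using hcan.redMod_dvd hmax (i := 1) (by norm_num) (g := g) (by simpa using hg)
  · simpa [hC] using hcan.redMod_dvd hmax (i := 2) (by norm_num) (g := g) hg

/-- Theorem 7.4 (nilpotency 3): Frobenius-local criteria for an ideal `I` with canonical
sequence `f₂ = r^{e₂}`, `f₁ = r^{e₁} + π b₁₁`,
`f₀ = r^{e₀} + π (b₁₁ r^{e₀-e₁} + b₀₁ r^{e₂}) + π² b₀₂`, `r̄` irreducible. -/
theorem chain_nilpotency_three_frobenius_local {R : Type*} [CommRing R] [IsLocalRing R]
    (π : R) (hmax : IsLocalRing.maximalIdeal R = Ideal.span {π})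
    (hnil : π ^ 3 = 0) (hπ : π ^ 2 ≠ 0)
    (r b11 b01 b02 : R[X]) (hr : Irreducible (redMod π r))
    (e0 e1 e2 : ℕ) (h21 : e2 ≤ e1) (h10 : e1 ≤ e0) (he0 : 0 < e0)
    (I : Ideal R[X])
    (hcan : IsCanonicalSequence π 3 I (fun j =>
      if j = 0 then
        r ^ e0 + C π * (b11 * r ^ (e0 - e1) + b01 * r ^ e2) + C π ^ 2 * b02
      else if j = 1 then r ^ e1 + C π * b11
      else r ^ e2)) :
    (({e0, e1, e2, 0} : Finset ℕ).card = 2 →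
      (IsFrobeniusRing (R[X] ⧸ I) ∧ IsLocalRing (R[X] ⧸ I))) ∧
    (e0 = e1 → e2 < e1 → 0 < e2 →
      ((IsFrobeniusRing (R[X] ⧸ I) ∧ IsLocalRing (R[X] ⧸ I)) ↔
        ¬ redMod π r ∣ redMod π b11)) ∧
    (e1 < e0 → e1 = e2 → 0 < e2 →
      ((IsFrobeniusRing (R[X] ⧸ I) ∧ IsLocalRing (R[X] ⧸ I)) ↔
        ¬ redMod π r ∣ (redMod π b02 - redMod π b01 * redMod π b11))) ∧
    (e1 < e0 → e2 < e1 → e2 = 0 →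
      ((IsFrobeniusRing (R[X] ⧸ I) ∧ IsLocalRing (R[X] ⧸ I)) ↔
        ¬ redMod π r ∣ redMod π b01)) ∧
    (e1 < e0 → e2 < e1 → 0 < e2 →
      ((IsFrobeniusRing (R[X] ⧸ I) ∧ IsLocalRing (R[X] ⧸ I)) ↔
        (¬ redMod π r ∣ redMod π b11 ∧ ¬ redMod π r ∣ redMod π b01))) := by
  have hmax' : (Ideal.span {π}).IsMaximal := hmax ▸ IsLocalRing.maximalIdeal.isMaximal R
  have : IsNoetherianRing R := isNoetherianRing_of_maximalIdeal_eq_span_singleton hmax ⟨3, hnil⟩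
  have : IsDomain (R ⧸ Ideal.span {π}) := Ideal.Quotient.isDomain _
  have : IsPrincipalIdealRing (R ⧸ Ideal.span {π})[X] := by
    let := Ideal.Quotient.field (Ideal.span {π})
    exact (inferInstance : IsPrincipalIdealRing (R ⧸ Ideal.span {π})[X])
  obtain ⟨c, rfl⟩ := Nat.exists_eq_add_of_le h21
  obtain ⟨d, rfl⟩ := Nat.exists_eq_add_of_le h10
  have h := hcan.isThreeStepIdeal hmax' hnil hr
  clear hcan h21 h10
  refine ⟨fun hcard => ?_, fun h1 h2 h3 => ?_, fun h1 h2 h3 => ?_, fun h1 h2 h3 => ?_,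
    fun h1 h2 h3 => ?_⟩
  · obtain ⟨x, y, -, hxy⟩ := Finset.card_eq_two.1 hcard
    simp only [Finset.ext_iff, Finset.mem_insert, Finset.mem_singleton] at hxy
    have hx0 := (hxy (e2 + c + d)).1 (by simp)
    have hx1 := (hxy (e2 + c)).1 (by simp)
    have hx2 := (hxy e2).1 (by simp)
    have hx3 := (hxy 0).1 (by simp)
    clear hxy hcard
    rcases e2 with _ | e <;> rcases c with _ | c <;> rcases d with _ | d
    · simp at he0
    · exact h.frobenius_of_last_two_zero
    · exact h.frobenius_of_last_zero
    · omega
    · exact h.frobenius_of_all_eq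
    · omega
    · omega
    · omega
  · obtain ⟨e, rfl⟩ := Nat.exists_eq_succ_of_ne_zero h3.ne'
    obtain ⟨c, rfl⟩ := Nat.exists_eq_succ_of_ne_zero (show c ≠ 0 by omega)
    obtain rfl : d = 0 := by omega
    exact h.frobenius_iff_of_first_eq
  · obtain ⟨e, rfl⟩ := Nat.exists_eq_succ_of_ne_zero h3.ne'
    obtain rfl : c = 0 := by omega
    obtain ⟨d, rfl⟩ := Nat.exists_eq_succ_of_ne_zero (show d ≠ 0 by omega)
    exact h.frobenius_iff_of_middle_eq
  · obtain rfl := h3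
    obtain ⟨c, rfl⟩ := Nat.exists_eq_succ_of_ne_zero (show c ≠ 0 by omega)
    obtain ⟨d, rfl⟩ := Nat.exists_eq_succ_of_ne_zero (show d ≠ 0 by omega)
    exact h.frobenius_iff_of_last_zero
  · obtain ⟨e, rfl⟩ := Nat.exists_eq_succ_of_ne_zero h3.ne'
    obtain ⟨c, rfl⟩ := Nat.exists_eq_succ_of_ne_zero (show c ≠ 0 by omega)
    obtain ⟨d, rfl⟩ := Nat.exists_eq_succ_of_ne_zero (show d ≠ 0 by omega)
    exact h.frobenius_iff_of_strict
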